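/- arXiv:1903.05491 — 4 statements merged into one kernel-verified Lean document; each statement's English description precedes it below -/
import Mathlib

section
/- Let E ⊆ ℂ be a number field, r ≥ 4 an even integer, and P ∈ E[X] a polynomial of degree r with r distinct roots, all of modulus 1 and none equal to ±1, whose set of roots M is closed under the involution ι : α ↦ α^{−1} (which is fixed-point free on M). Let K ⊆ ℂ be the splitting field of P over E, and assume that the image of the permutation action of Gal(K/E) on M is the full centralizer of ι in Sym(M), a group of order 2^{r/2}·(r/2)!. Then the multiplicative relations among the roots are exactly the ones forced by the pairing: Rel_m(M) = {(n_α)_{α∈M} ∈ ℤ^M : n_α = n_{α^{−1}} for all α ∈ M}. -/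
/-- for a degree-`r` polynomial (`r ≥ 4` even) over a number field
`E ⊆ ℂ` whose `r` distinct roots have modulus `1`, avoid `±1`, and are closed
under inversion, if the Galois action on the roots is the full centralizer of
the inversion involution (the hyperoctahedral group of order `2^{r/2}(r/2)!`),
then the multiplicative relations among the roots are exactly those with
`n_α = n_{α⁻¹}` for all roots `α`. -/
theorem multiplicative_relations_hyperoctahedral
    (E : IntermediateField ℚ ℂ) [FiniteDimensional ℚ E]
    (r : ℕ) (hr : 4 ≤ r) (hre : Even r) (P : Polynomial E) (hdeg : P.natDegree = r)
    (roots : Finset ℂ) (hroots : ∀ α : ℂ, α ∈ roots ↔ Polynomial.aeval α P = 0)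
    (hcard : roots.card = r)
    (habs : ∀ α ∈ roots, ‖α‖ = 1)
    (h1 : (1 : ℂ) ∉ roots) (hm1 : (-1 : ℂ) ∉ roots)
    (hinv : ∀ α ∈ roots, α⁻¹ ∈ roots)
    (hGal : ∀ τ : Equiv.Perm ℂ, (∀ α ∈ roots, τ α ∈ roots) →
      (∀ α ∈ roots, τ α⁻¹ = (τ α)⁻¹) →
      ∃ g : ℂ ≃ₐ[E] ℂ, ∀ α ∈ roots, g α = τ α)
    (n : ℂ → ℤ) :
    (∏ α ∈ roots, α ^ n α = 1) ↔ ∀ α ∈ roots, n α = n α⁻¹ := by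
  have hne0 : ∀ α ∈ roots, α ≠ 0 := by
    intro α hα h0
    have := habs α hα
    simp [h0] at this
  have hneinv : ∀ α ∈ roots, α⁻¹ ≠ α := by
    intro α hα h
    have h0 := hne0 α hα
    have h2 : α * α = 1 := by
      nth_rewrite 1 [← h]
      exact inv_mul_cancel₀ h0
    rcases mul_self_eq_one_iff.mp h2 with h3 | h3
    · exact h1 (h3 ▸ hα)
    · exact hm1 (h3 ▸ hα)
  constructor
  · intro hprod a ha
    by_contra hn
    have ha0 := hne0 a ha
    have hai := hneinv a ha
    -- the swap of `a` and its inverse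
    obtain ⟨g, hg⟩ := hGal (Equiv.swap a a⁻¹)
      (by
        intro α hα
        rw [Equiv.swap_apply_def]
        split_ifs
        · exact hinv a ha
        · exact ha
        · exact hα)
      (by
        intro α hα
        by_cases h : α = a
        · subst h; simp
        by_cases h' : α = a⁻¹
        · subst h'; simp
        rw [Equiv.swap_apply_of_ne_of_ne h h', Equiv.swap_apply_of_ne_of_ne]
        · intro h2; exact h' (by rw [← h2, inv_inv])
        · intro h2; exact h (inv_injective h2))
    have hga : g a = a⁻¹ := by rw [hg a ha, Equiv.swap_apply_left]
    have hgfix : ∀ α ∈ roots, α ≠ a → α ≠ a⁻¹ → g α = α := by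
      intro α hα h h'
      rw [hg α hα, Equiv.swap_apply_of_ne_of_ne h h']
    have hq : ∏ α ∈ roots, (α ^ n α / g (α ^ n α)) = 1 := by
      rw [Finset.prod_div_distrib, ← map_prod, hprod, map_one, div_one]
    rw [Finset.prod_eq_mul a a⁻¹ hai.symm
      (by
        rintro c hc ⟨h, h'⟩
        rw [map_zpow₀, hgfix c hc h h', div_self (zpow_ne_zero _ (hne0 c hc))])
      (fun h => absurd ha h) (fun h => absurd (hinv a ha) h)] at hq
    have hpow : a ^ (2 * (n a - n a⁻¹)) = 1 := by
      rw [← hq]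
      simp only [map_zpow₀, map_inv₀, hga, inv_inv, inv_zpow', div_eq_mul_inv, ← zpow_neg,
        ← zpow_add₀ ha0]
      congr 1
      ring
    have hfin : IsOfFinOrder a := by
      rw [isOfFinOrder_iff_zpow_eq_one]
      exact ⟨_, by omega, hpow⟩
    -- another root
    obtain ⟨b, hb, hba⟩ : ∃ b ∈ roots, b ∉ ({a, a⁻¹} : Finset ℂ) := by
      apply Finset.exists_mem_notMem_of_card_lt_card
      have := Finset.card_le_two (a := a) (b := a⁻¹)
      omega
    simp only [Finset.mem_insert, Finset.mem_singleton, not_or] at hba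
    obtain ⟨hba, hbai⟩ := hba
    have hbi := hneinv b hb
    have hb_ai : b⁻¹ ≠ a := fun h => hbai (by rw [← h, inv_inv])
    have hbi_ai : b⁻¹ ≠ a⁻¹ := fun h => hba (inv_injective h)
    have hτ : ∀ α, (Equiv.swap a b * Equiv.swap a⁻¹ b⁻¹) α =
        if α = a then b else if α = b then a else if α = a⁻¹ then b⁻¹ else
        if α = b⁻¹ then a⁻¹ else α := by
      intro α
      simp only [Equiv.Perm.mul_apply, Equiv.swap_apply_def]
      grind
    obtain ⟨f, hf⟩ := hGal (Equiv.swap a b * Equiv.swap a⁻¹ b⁻¹)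
      (by
        intro α hα
        rw [hτ]
        split_ifs
        · exact hb
        · exact ha
        · exact hinv b hb
        · exact hinv a ha
        · exact hα)
      (by
        intro α hα
        rw [hτ, hτ]
        have e1 : α⁻¹ = a ↔ α = a⁻¹ := inv_eq_iff_eq_inv
        have e2 : α⁻¹ = b ↔ α = b⁻¹ := inv_eq_iff_eq_inv
        simp only [inv_inj, e1, e2]
        by_cases c1 : α = a
        · subst c1
          rw [if_neg hai.symm, if_neg hb_ai.symm, if_pos rfl, if_pos rfl]
        by_cases c2 : α = b
        · subst c2
          rw [if_neg hbai, if_neg hbi.symm, if_neg hba, if_pos rfl, if_neg hba, if_pos rfl]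
        simp only [if_neg c1, if_neg c2]
        split_ifs <;> simp)
    have hfa : f a = b := by rw [hf a ha, hτ, if_pos rfl]
    obtain ⟨k, hk, hak⟩ := isOfFinOrder_iff_pow_eq_one.mp hfin
    have hbk : b ^ k = 1 := by rw [← hfa, ← map_pow, hak, map_one]
    have hbpos : 0 < orderOf b := orderOf_pos_iff.mpr (isOfFinOrder_iff_pow_eq_one.mpr ⟨k, hk, hbk⟩)
    have hao : a ^ orderOf b = 1 := by
      apply f.injective
      rw [map_pow, hfa, map_one, pow_orderOf_eq_one]
    haveI : NeZero (orderOf b) := ⟨hbpos.ne'⟩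
    obtain ⟨i, -, hi⟩ := (IsPrimitiveRoot.orderOf b).eq_pow_of_pow_eq_one hao
    apply hai
    rw [← hga, ← hi, map_pow, hgfix b hb hba hbai]
  · intro h
    refine Finset.prod_involution (fun α _ => α⁻¹) ?_ ?_ ?_ ?_
    · intro α hα
      rw [← h α hα, inv_zpow, mul_inv_cancel₀ (zpow_ne_zero _ (hne0 α hα))]
    · intro α hα _
      exact hneinv α hα
    · intro α hα
      exact hinv α hα
    · intro α hα
      exact inv_inv α
end

section
/- Let E ⊆ ℂ be a number field, t ≥ 1 and r ≥ 3 integers, and P_1, …, P_t ∈ E[X] polynomials of degree r with pairwise disjoint root sets M_1, …, M_t ⊆ ℂ, where each M_i consists of r distinct nonzero numbers whose product is 1 (∏_{α∈M_i} α = 1). Let K ⊆ ℂ be the splitting field of P_1⋯P_t over E, and assume that the permutation action of Gal(K/E) on M = M_1 ∪ ⋯ ∪ M_t induces the full product Sym(M_1) × ⋯ × Sym(M_t). Then the multiplicative relations among the roots are exactly the trivial ones: Rel_m(M) = {(n_α)_{α∈M} ∈ ℤ^M : for each 1 ≤ i ≤ t, the exponents n_α are constant for α ∈ M_i}. -/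
/-- for `t` degree-`r` polynomials (`r ≥ 3`) over a number field
`E ⊆ ℂ` with pairwise disjoint root sets, each consisting of `r` distinct
nonzero numbers of product `1`, if the Galois action on the roots induces the
full product `Sym(M_1) × ⋯ × Sym(M_t)`, then the multiplicative relations among
the roots are exactly the trivial ones (exponents constant on each `M_i`). -/
theorem multiplicative_relations_product_symmetric
    (E : IntermediateField ℚ ℂ) [FiniteDimensional ℚ E]
    (t r : ℕ) (ht : 1 ≤ t) (hr : 3 ≤ r)
    (P : Fin t → Polynomial E) (hdeg : ∀ i, (P i).natDegree = r)
    (roots : Fin t → Finset ℂ)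
    (hroots : ∀ i, ∀ α : ℂ, α ∈ roots i ↔ Polynomial.aeval α (P i) = 0)
    (hcard : ∀ i, (roots i).card = r)
    (h0 : ∀ i, (0 : ℂ) ∉ roots i)
    (hdisj : ∀ i j, i ≠ j → Disjoint (roots i) (roots j))
    (hprod : ∀ i, ∏ α ∈ roots i, α = 1)
    (hGal : ∀ τ : Equiv.Perm ℂ, (∀ i, ∀ α ∈ roots i, τ α ∈ roots i) →
      ∃ g : ℂ ≃ₐ[E] ℂ, ∀ i, ∀ α ∈ roots i, g α = τ α)
    (n : ℂ → ℤ) :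
    (∏ i, ∏ α ∈ roots i, α ^ n α = 1) ↔
      ∀ i, ∀ α ∈ roots i, ∀ β ∈ roots i, n α = n β := by
  classical
  have hswap : ∀ i, ∀ a ∈ roots i, ∀ b ∈ roots i, ∃ g : ℂ ≃ₐ[E] ℂ,
      ∀ j, ∀ x ∈ roots j, g x = Equiv.swap a b x := by
    intro i a ha b hb
    apply hGal
    intro j x hx
    by_cases hij : i = j
    · subst hij
      by_cases h1 : x = a
      · subst h1; simpa using hb
      by_cases h2 : x = b
      · subst h2; simpa using ha
      rwa [Equiv.swap_apply_of_ne_of_ne h1 h2]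
    · have h := Finset.disjoint_left.mp (hdisj i j hij)
      rwa [Equiv.swap_apply_of_ne_of_ne]
      · rintro rfl; exact h ha hx
      · rintro rfl; exact h hb hx
  have hne : ∀ i, ∀ a ∈ roots i, a ≠ 0 := fun i a ha h => h0 i (h ▸ ha)
  constructor
  · intro hrel i a ha b hb
    by_contra hn
    have hab : a ≠ b := fun h => hn (by rw [h])
    have ha0 := hne i a ha
    have hb0 := hne i b hb
    -- all `m`-th powers agree
    have hpow : a ^ (n a - n b) = b ^ (n a - n b) := by
      obtain ⟨g, hg⟩ := hswap i a ha b hb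
      have h1 : ∏ j, ∏ x ∈ roots j, (Equiv.swap a b x) ^ n x = 1 := by
        have := congrArg g hrel
        rw [map_one, map_prod] at this
        rw [← this]
        refine Finset.prod_congr rfl fun j _ => ?_
        rw [map_prod]
        refine Finset.prod_congr rfl fun x hx => ?_
        rw [map_zpow₀, hg j x hx]
      have h2 : ∏ j, ∏ x ∈ roots j, (x / Equiv.swap a b x) ^ n x = 1 := by
        simp_rw [div_zpow, Finset.prod_div_distrib]
        rw [hrel, h1, div_one]
      rw [Finset.prod_eq_single i, Finset.prod_eq_mul a b hab] at h2
      · rw [Equiv.swap_apply_left, Equiv.swap_apply_right, div_zpow, div_zpow] at h2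
        rw [zpow_sub₀ ha0, zpow_sub₀ hb0]
        have := zpow_ne_zero (n a) ha0
        have := zpow_ne_zero (n b) ha0
        have := zpow_ne_zero (n a) hb0
        have := zpow_ne_zero (n b) hb0
        field_simp at h2 ⊢
        linear_combination h2
      · intro x hx hxx
        rw [Equiv.swap_apply_of_ne_of_ne hxx.1 hxx.2, div_self (hne i x hx), one_zpow]
      · exact fun h => absurd ha h
      · exact fun h => absurd hb h
      · intro j _ hj
        refine Finset.prod_eq_one fun x hx => ?_
        have h := Finset.disjoint_left.mp (hdisj j i hj) hx
        rw [Equiv.swap_apply_of_ne_of_ne, div_self (hne j x hx), one_zpow]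
        · rintro rfl; exact h ha
        · rintro rfl; exact h hb
      · exact fun h => absurd (Finset.mem_univ i) h
    have hm : n a - n b ≠ 0 := sub_ne_zero.mpr hn
    generalize n a - n b = m at hpow hm
    have hall : ∀ x ∈ roots i, x ^ m = a ^ m := by
      intro x hx
      by_cases hxa : x = a
      · rw [hxa]
      obtain ⟨g, hg⟩ := hswap i b hb x hx
      have := congrArg g hpow
      rw [map_zpow₀, map_zpow₀, hg i a ha, hg i b hb, Equiv.swap_apply_left,
        Equiv.swap_apply_of_ne_of_ne hab (Ne.symm hxa)] at this
      exact this.symm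
    have hroot : (a ^ m) ^ r = 1 := by
      rw [← hcard i, ← Finset.prod_const, ← Finset.prod_congr rfl hall, Finset.prod_zpow,
        hprod, one_zpow]
    have hfin : IsOfFinOrder a := by
      rw [isOfFinOrder_iff_pow_eq_one]
      refine ⟨m.natAbs * r, Nat.mul_pos (Int.natAbs_pos.mpr hm) (by omega), ?_⟩
      rcases Int.natAbs_eq m with h | h
      · rw [h, zpow_natCast, ← pow_mul] at hroot
        exact hroot
      · rw [h, zpow_neg, zpow_natCast, inv_pow, inv_eq_one, ← pow_mul] at hroot
        exact hroot
    have hord : 0 < orderOf a := hfin.orderOf_pos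
    obtain ⟨k, hk⟩ : ∃ k : ℕ, a ^ k = b := by
      obtain ⟨g, hg⟩ := hswap i a ha b hb
      have hgb : g a = b := by rw [hg i a ha, Equiv.swap_apply_left]
      have : NeZero (orderOf a) := ⟨hord.ne'⟩
      obtain ⟨k, _, hk⟩ := (IsPrimitiveRoot.orderOf a).eq_pow_of_pow_eq_one (ξ := b)
        (by rw [← hgb, ← map_pow, pow_orderOf_eq_one, map_one])
      exact ⟨k, hk⟩
    obtain ⟨c, hc, hca, hcb⟩ : ∃ c ∈ roots i, c ≠ a ∧ c ≠ b := by
      obtain ⟨c, hc, hc'⟩ := Finset.exists_mem_notMem_of_card_lt_card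
        (s := {a, b}) (t := roots i)
        (by rw [hcard]; exact lt_of_le_of_lt Finset.card_le_two (by omega))
      simp only [Finset.mem_insert, Finset.mem_singleton, not_or] at hc'
      exact ⟨c, hc, hc'⟩
    obtain ⟨h, hh⟩ := hswap i b hb c hc
    have e1 : h a = a := by rw [hh i a ha, Equiv.swap_apply_of_ne_of_ne hab hca.symm]
    have e2 : h b = c := by rw [hh i b hb, Equiv.swap_apply_left]
    rw [← hk, map_pow, e1, hk] at e2
    exact hcb e2.symm
  · intro hc
    refine Finset.prod_eq_one fun i _ => ?_
    rcases (roots i).eq_empty_or_nonempty with he | ⟨a, ha⟩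
    · rw [he, Finset.prod_empty]
    · rw [Finset.prod_congr rfl fun x hx => by rw [hc i x hx a ha], Finset.prod_zpow, hprod,
        one_zpow]
end

section
/- Let E ⊆ ℂ be a number field, t ≥ 1 an integer, r ≥ 4 an even integer, and P_1, …, P_t ∈ E[X] polynomials of degree r with pairwise disjoint root sets M_1, …, M_t ⊆ ℂ, where each M_i consists of r distinct numbers of modulus 1, none equal to ±1, and is closed under the involution α ↦ α^{−1}. Let K ⊆ ℂ be the splitting field of P_1⋯P_t over E, and assume that the image of the permutation action of Gal(K/E) on M = M_1 ∪ ⋯ ∪ M_t is the full product of the centralizers in Sym(M_i) of the involutions α ↦ α^{−1}, i.e. a group of order (2^{r/2}(r/2)!)^t. Then the multiplicative relations among the roots are exactly the ones forced by the pairings: Rel_m(M) = {(n_α)_{α∈M} ∈ ℤ^M : n_α = n_{α^{−1}} for all α ∈ M}. -/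
/-- for `t` degree-`r` polynomials (`r ≥ 4` even) over a number
field `E ⊆ ℂ` with pairwise disjoint root sets, each consisting of `r` distinct
numbers of modulus `1`, avoiding `±1` and closed under inversion, if the Galois
action on the roots is the full product of the hyperoctahedral centralizers
(order `(2^{r/2}(r/2)!)^t`), then the multiplicative relations among the roots
are exactly those with `n_α = n_{α⁻¹}` for all roots `α`. -/
theorem multiplicative_relations_product_hyperoctahedral
    (E : IntermediateField ℚ ℂ) [FiniteDimensional ℚ E]
    (t r : ℕ) (ht : 1 ≤ t) (hr : 4 ≤ r) (hre : Even r)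
    (P : Fin t → Polynomial E) (hdeg : ∀ i, (P i).natDegree = r)
    (roots : Fin t → Finset ℂ)
    (hroots : ∀ i, ∀ α : ℂ, α ∈ roots i ↔ Polynomial.aeval α (P i) = 0)
    (hcard : ∀ i, (roots i).card = r)
    (habs : ∀ i, ∀ α ∈ roots i, ‖α‖ = 1)
    (h1 : ∀ i, (1 : ℂ) ∉ roots i) (hm1 : ∀ i, (-1 : ℂ) ∉ roots i)
    (hinv : ∀ i, ∀ α ∈ roots i, α⁻¹ ∈ roots i)
    (hdisj : ∀ i j, i ≠ j → Disjoint (roots i) (roots j))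
    (hGal : ∀ τ : Equiv.Perm ℂ, (∀ i, ∀ α ∈ roots i, τ α ∈ roots i) →
      (∀ i, ∀ α ∈ roots i, τ α⁻¹ = (τ α)⁻¹) →
      ∃ g : ℂ ≃ₐ[E] ℂ, ∀ i, ∀ α ∈ roots i, g α = τ α)
    (n : ℂ → ℤ) :
    (∏ i, ∏ α ∈ roots i, α ^ n α = 1) ↔
      ∀ i, ∀ α ∈ roots i, n α = n α⁻¹ := by
  classical
  have hne0 : ∀ i, ∀ α ∈ roots i, α ≠ 0 := by
    intro i α hα h0
    have := habs i α hα
    simp [h0] at this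
  have hneinv : ∀ i, ∀ α ∈ roots i, α ≠ α⁻¹ := by
    intro i α hα h
    have h0 := hne0 i α hα
    have h2 : α * α = 1 := by
      nth_rewrite 2 [h]
      exact mul_inv_cancel₀ h0
    rcases mul_self_eq_one_iff.mp h2 with h3 | h3
    · exact h1 i (h3 ▸ hα)
    · exact hm1 i (h3 ▸ hα)
  constructor
  · intro hrel i α hα
    have hα0 := hne0 i α hα
    have hαi := hneinv i α hα
    have hαm := hinv i α hα
    obtain ⟨g, hg⟩ := hGal (Equiv.swap α α⁻¹)
      (by
        intro j γ hγ
        by_cases e1 : γ = α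
        · subst e1
          rw [Equiv.swap_apply_left]
          exact hinv j _ hγ
        · by_cases e2 : γ = α⁻¹
          · subst e2
            rw [Equiv.swap_apply_right]
            simpa using hinv j _ hγ
          · rwa [Equiv.swap_apply_of_ne_of_ne e1 e2])
      (by
        intro j γ hγ
        by_cases e1 : γ = α
        · subst e1
          simp
        · by_cases e2 : γ = α⁻¹
          · subst e2
            simp
          · rw [Equiv.swap_apply_of_ne_of_ne e1 e2, Equiv.swap_apply_of_ne_of_ne]
            · intro h
              exact e2 (by rw [← h, inv_inv])
            · intro h
              exact e1 (inv_injective h))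
    by_contra hn
    -- the relation forces `α` to be a root of unity
    have hrel2 : ∏ j, ∏ γ ∈ roots j, (g γ) ^ n γ = 1 := by
      have := congrArg g hrel
      simpa [map_prod, map_zpow₀] using this
    have hq : ∏ j, ∏ γ ∈ roots j, ((g γ) ^ n γ / γ ^ n γ) = 1 := by
      simp only [Finset.prod_div_distrib]
      rw [hrel, hrel2, div_one]
    have hfix : ∀ j, ∀ γ ∈ roots j, γ ≠ α → γ ≠ α⁻¹ → (g γ) ^ n γ / γ ^ n γ = 1 := by
      intro j γ hγ e1 e2
      rw [hg j γ hγ, Equiv.swap_apply_of_ne_of_ne e1 e2]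
      exact div_self (zpow_ne_zero _ (hne0 j γ hγ))
    rw [Finset.prod_eq_single i
      (by
        intro j _ hji
        refine Finset.prod_eq_one fun γ hγ => hfix j γ hγ ?_ ?_
        · rintro rfl
          exact Finset.disjoint_left.mp (hdisj j i hji) hγ hα
        · rintro rfl
          exact Finset.disjoint_left.mp (hdisj j i hji) hγ hαm)
      (by simp),
      Finset.prod_eq_mul α α⁻¹ hαi (fun γ hγ h => hfix i γ hγ h.1 h.2)
        (fun h => absurd hα h) (fun h => absurd hαm h),
      hg i α hα, hg i _ hαm, Equiv.swap_apply_left, Equiv.swap_apply_right] at hq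
    have hz : α ^ (2 * (n α⁻¹ - n α)) = 1 := by
      rw [← hq]
      simp only [inv_zpow', div_eq_mul_inv, ← zpow_neg, neg_neg, ← zpow_add₀ hα0]
      congr 1
      ring
    have hfin : IsOfFinOrder α := by
      rw [isOfFinOrder_iff_zpow_eq_one]
      exact ⟨_, by omega, hz⟩
    -- choose another root `β`
    obtain ⟨β, hβ, hβα, hβi⟩ : ∃ β ∈ roots i, β ≠ α ∧ β ≠ α⁻¹ := by
      have : ∃ β ∈ roots i, β ∉ ({α, α⁻¹} : Finset ℂ) := by
        apply Finset.exists_mem_notMem_of_card_lt_card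
        have := Finset.card_le_two (a := α) (b := α⁻¹)
        rw [hcard i]
        omega
      obtain ⟨β, hβ, h⟩ := this
      simp only [Finset.mem_insert, Finset.mem_singleton, not_or] at h
      exact ⟨β, hβ, h.1, h.2⟩
    have hβm := hinv i β hβ
    have hββ := hneinv i β hβ
    have hmem : ∀ j, ∀ γ ∈ roots j, γ ∈ roots i → j = i := by
      intro j γ h h'
      by_contra hji
      exact Finset.disjoint_left.mp (hdisj j i hji) h h'
    have k1 : β⁻¹ ≠ α := fun h => hβi (by rw [← h, inv_inv])
    have k2 : β⁻¹ ≠ α⁻¹ := fun h => hβα (inv_injective h)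
    obtain ⟨g', hg'⟩ := hGal (Equiv.swap α β * Equiv.swap α⁻¹ β⁻¹)
      (by
        intro j γ hγ
        by_cases hj : γ ∈ roots i
        · obtain rfl := hmem j γ hγ hj
          simp only [Equiv.Perm.mul_apply, Equiv.swap_apply_def]
          split_ifs <;> assumption
        · have a1 : γ ≠ α := fun h => hj (h ▸ hα)
          have a2 : γ ≠ α⁻¹ := fun h => hj (h ▸ hαm)
          have a3 : γ ≠ β := fun h => hj (h ▸ hβ)
          have a4 : γ ≠ β⁻¹ := fun h => hj (h ▸ hβm)
          rw [Equiv.Perm.mul_apply, Equiv.swap_apply_of_ne_of_ne a2 a4,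
            Equiv.swap_apply_of_ne_of_ne a1 a3]
          exact hγ)
      (by
        intro j γ hγ
        have b1 : γ⁻¹ = α ↔ γ = α⁻¹ := inv_eq_iff_eq_inv
        have b2 : γ⁻¹ = β ↔ γ = β⁻¹ := inv_eq_iff_eq_inv
        simp only [Equiv.Perm.mul_apply, Equiv.swap_apply_def, inv_inj]
        by_cases c1 : γ = α
        · subst c1
          simp [hαi, k1, k1.symm, k2, hββ.symm, hβα, hβα.symm]
        · by_cases c2 : γ = β
          · subst c2
            simp [hβα, hβi, hββ, hαi.symm, hβi.symm]
          · by_cases c3 : γ = α⁻¹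
            · subst c3
              simp [hαi.symm, hβi.symm, k1, hββ.symm]
            · by_cases c4 : γ = β⁻¹
              · subst c4
                simp [k1, k2, hββ.symm, hβα, hβi.symm, hαi.symm]
              · simp [b1, b2, c1, c2, c3, c4])
    have hgα : g' α = β := by
      rw [hg' i α hα, Equiv.Perm.mul_apply, Equiv.swap_apply_of_ne_of_ne hαi k1.symm,
        Equiv.swap_apply_left]
    have hprim := IsPrimitiveRoot.orderOf α
    haveI : NeZero (orderOf α) := ⟨hfin.orderOf_pos.ne'⟩
    obtain ⟨k, -, hk⟩ := hprim.eq_pow_of_pow_eq_one (ξ := β)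
      (by rw [← hgα, ← map_pow, pow_orderOf_eq_one, map_one])
    have e1 : g β = β := by
      rw [hg i β hβ, Equiv.swap_apply_of_ne_of_ne hβα hβi]
    have e2 : g β = β⁻¹ := by
      rw [← hk, map_pow, hg i α hα, Equiv.swap_apply_left, inv_pow]
    exact hββ (e1.symm.trans e2)
  · intro h
    refine Finset.prod_eq_one fun i _ => ?_
    refine Finset.prod_involution (fun γ _ => γ⁻¹) ?_ ?_ ?_ ?_
    · intro γ hγ
      rw [← h i γ hγ, ← mul_zpow, mul_inv_cancel₀ (hne0 i γ hγ), one_zpow]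
    · intro γ hγ _ h'
      exact hneinv i γ hγ h'.symm
    · intro γ hγ
      exact hinv i γ hγ
    · intro γ hγ
      exact inv_inv γ
end

section
/- Let E ⊆ ℂ be a number field, t ≥ 1 and r ≥ 3 integers, and P_1, …, P_t ∈ E[X] polynomials of degree r with pairwise disjoint root sets M_1, …, M_t ⊆ ℂ, where each M_i consists of r distinct numbers, all of modulus 1, with ∏_{α∈M_i} α = 1. Write the roots of P_i as e(θ_{i,1}), …, e(θ_{i,r}) with θ_{i,j} ∈ [0,1). Let K ⊆ ℂ be the splitting field of P_1⋯P_t over E, and assume that the permutation action of Gal(K/E) on M_1 ∪ ⋯ ∪ M_t induces the full product Sym(M_1) × ⋯ × Sym(M_t). Then the real numbers 1 and θ_{i,j} for 1 ≤ i ≤ t and 1 ≤ j ≤ r−1 are ℚ-linearly independent. -/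
theorem key_const
    (E : IntermediateField ℚ ℂ)
    (t r : ℕ) (hr : 3 ≤ r)
    (a : Fin t → Fin r → ℂ)
    (roots : Fin t → Finset ℂ)
    (hcard : ∀ i, (roots i).card = r)
    (hparam : ∀ i, ∀ α : ℂ, α ∈ roots i ↔ ∃ j, α = a i j)
    (ha0 : ∀ i j, a i j ≠ 0)
    (hdisj : ∀ i j, i ≠ j → Disjoint (roots i) (roots j))
    (hprod : ∀ i, ∏ α ∈ roots i, α = 1)
    (hGal : ∀ τ : Equiv.Perm ℂ, (∀ i, ∀ α ∈ roots i, τ α ∈ roots i) →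
      ∃ g : ℂ ≃ₐ[E] ℂ, ∀ i, ∀ α ∈ roots i, g α = τ α)
    (n : Fin t → Fin r → ℤ) (hn : ∏ p : Fin t × Fin r, a p.1 p.2 ^ n p.1 p.2 = 1)
    (i : Fin t) (j k : Fin r) : n i j = n i k := by
  classical
  have hmem : ∀ i j, a i j ∈ roots i := fun i j => (hparam i _).2 ⟨j, rfl⟩
  have himg : ∀ i, Finset.univ.image (a i) = roots i := by
    intro i; ext α; rw [hparam]; simp [eq_comm]
  have hinj : ∀ i, Function.Injective (a i) := by
    intro i
    rw [← Finset.card_image_iff.trans (by simp [Set.injOn_univ] :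
      Set.InjOn (a i) (Finset.univ : Finset (Fin r)) ↔ Function.Injective (a i)), himg, hcard]
    simp
  have hsep : ∀ i₁ i₂ x, x ∈ roots i₁ → x ∈ roots i₂ → i₁ = i₂ := by
    intro i₁ i₂ x h1 h2
    by_contra h
    exact Finset.disjoint_left.1 (hdisj _ _ h) h1 h2
  -- swaps are realised by automorphisms
  have hswap : ∀ x ∈ roots i, ∀ y ∈ roots i, ∃ g : ℂ ≃ₐ[E] ℂ,
      ∀ i₀, ∀ α ∈ roots i₀, g α = Equiv.swap x y α := by
    intro x hx y hy
    apply hGal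
    intro i₀ α hα
    rw [Equiv.swap_apply_def]
    split_ifs with h1 h2
    · subst h1; rwa [hsep _ _ _ hα hx]
    · subst h2; rwa [hsep _ _ _ hα hy]
    · exact hα
  by_contra hne
  have hjk : j ≠ k := by rintro rfl; exact hne rfl
  have hxy : a i j ≠ a i k := fun h => hjk (hinj i h)
  set m : ℤ := n i j - n i k with hm
  have hm0 : m ≠ 0 := sub_ne_zero.2 hne
  have h1 : a i j ^ m = a i k ^ m := by
    obtain ⟨g, hg⟩ := hswap _ (hmem i j) _ (hmem i k)
    have h2 : ∏ p : Fin t × Fin r, (Equiv.swap (a i j) (a i k) (a p.1 p.2)) ^ n p.1 p.2 = 1 := by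
      have := congrArg g hn
      rw [map_prod, map_one] at this
      rw [← this]
      refine Finset.prod_congr rfl fun p _ => ?_
      rw [map_zpow₀, hg _ _ (hmem p.1 p.2)]
    have h3 : ∏ p : Fin t × Fin r,
        (Equiv.swap (a i j) (a i k) (a p.1 p.2)) ^ n p.1 p.2 / a p.1 p.2 ^ n p.1 p.2 = 1 := by
      rw [Finset.prod_div_distrib, h2, hn, div_one]
    rw [Fintype.prod_eq_mul (i, j) (i, k) (by simp [hjk])] at h3
    · simp only [Equiv.swap_apply_left, Equiv.swap_apply_right] at h3
      have hj := ha0 i j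
      have hk := ha0 i k
      rw [hm, zpow_sub₀ hj, zpow_sub₀ hk]
      have := zpow_ne_zero (n i j) hj
      have := zpow_ne_zero (n i j) hk
      have := zpow_ne_zero (n i k) hj
      have := zpow_ne_zero (n i k) hk
      field_simp at h3 ⊢
      rw [← h3]
    · rintro ⟨i₀, j₀⟩ ⟨hp1, hp2⟩
      have e1 : a i₀ j₀ ≠ a i j := by
        intro h
        have := hsep i₀ i _ (hmem i₀ j₀) (h ▸ hmem i j)
        subst this
        exact hp1 (by rw [hinj _ h])
      have e2 : a i₀ j₀ ≠ a i k := by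
        intro h
        have := hsep i₀ i _ (hmem i₀ j₀) (h ▸ hmem i k)
        subst this
        exact hp2 (by rw [hinj _ h])
      simp only [Equiv.swap_apply_of_ne_of_ne e1 e2]
      exact div_self (zpow_ne_zero _ (ha0 _ _))
  have h4 : ∀ β ∈ roots i, β ^ m = a i j ^ m := by
    intro β hβ
    by_cases hb : β = a i j
    · rw [hb]
    obtain ⟨g, hg⟩ := hswap _ (hmem i k) _ hβ
    have := congrArg g h1
    rw [map_zpow₀, map_zpow₀, hg _ _ (hmem i j), hg _ _ (hmem i k), Equiv.swap_apply_left,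
      Equiv.swap_apply_of_ne_of_ne hxy (Ne.symm hb)] at this
    exact this.symm
  have h5 : (a i j ^ m) ^ r = 1 := by
    have : ∏ β ∈ roots i, β ^ m = 1 := by
      rw [Finset.prod_zpow, hprod, one_zpow]
    rw [Finset.prod_congr rfl h4, Finset.prod_const, hcard] at this
    exact this
  have h6 : ∀ β ∈ roots i, β ^ (m.natAbs * r) = 1 := by
    intro β hβ
    have h : (β ^ m) ^ r = 1 := by rw [h4 β hβ, h5]
    rw [pow_mul]
    rcases Int.natAbs_eq m with hcase | hcase <;> rw [hcase] at h
    · rwa [zpow_natCast] at h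
    · rwa [zpow_neg, inv_pow, inv_eq_one, zpow_natCast] at h
  have hN : NeZero (m.natAbs * r) := ⟨by
    have := Int.natAbs_ne_zero.2 hm0
    positivity⟩
  obtain ⟨l, hl⟩ : ∃ l : Fin r, l ≠ j ∧ l ≠ k := by
    have : ({j, k} : Finset (Fin r)).card < (Finset.univ : Finset (Fin r)).card := by
      rw [Finset.card_univ, Fintype.card_fin]
      exact lt_of_le_of_lt Finset.card_le_two (by omega)
    obtain ⟨l, _, hl⟩ := Finset.exists_mem_notMem_of_card_lt_card this
    exact ⟨l, by simpa using hl⟩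
  have hpow : ∀ g : ℂ ≃ₐ[E] ℂ, ∃ s : ℤ, ∀ β ∈ roots i, g β = β ^ s := by
    intro g
    obtain ⟨s, hs⟩ := rootsOfUnity.integer_power_of_ringEquiv (m.natAbs * r) g.toRingEquiv
    refine ⟨s, fun β hβ => ?_⟩
    have := hs (rootsOfUnity.mkOfPowEq β (h6 β hβ))
    simpa using this
  obtain ⟨g, hg⟩ := hswap _ (hmem i j) _ (hmem i k)
  obtain ⟨h, hh⟩ := hswap _ (hmem i k) _ (hmem i l)
  obtain ⟨s, hs⟩ := hpow g
  obtain ⟨u, hu⟩ := hpow h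
  have hxl : a i j ≠ a i l := fun e => hl.1 (hinj i e).symm
  have hyl : a i k ≠ a i l := fun e => hl.2 (hinj i e).symm
  have gx : g (a i j) = a i k := by rw [hg _ _ (hmem i j), Equiv.swap_apply_left]
  have hx : h (a i j) = a i j := by
    rw [hh _ _ (hmem i j), Equiv.swap_apply_of_ne_of_ne hxy hxl]
  have hy : h (a i k) = a i l := by rw [hh _ _ (hmem i k), Equiv.swap_apply_left]
  apply hyl
  rw [← hy, ← gx, hs _ (hmem i j), map_zpow₀, hx]

/-- `e(x) = exp(2πix)`. -/
noncomputable def eReal (x : ℝ) : ℂ := Complex.exp (2 * Real.pi * Complex.I * x)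

/-- for `t` degree-`r` polynomials (`r ≥ 3`) over a number field
`E ⊆ ℂ` with pairwise disjoint root sets, each consisting of `r` distinct
numbers `e(θ_{i,1}), …, e(θ_{i,r})` of modulus `1` and product `1`, if the
Galois action on the roots induces the full product `Sym(M_1) × ⋯ × Sym(M_t)`,
then `1` and the `θ_{i,j}` for `1 ≤ j ≤ r−1` are ℚ-linearly independent. -/
theorem angles_linear_independence_symmetric
    (E : IntermediateField ℚ ℂ) [FiniteDimensional ℚ E]
    (t r : ℕ) (ht : 1 ≤ t) (hr : 3 ≤ r)
    (P : Fin t → Polynomial E) (hdeg : ∀ i, (P i).natDegree = r)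
    (θ : Fin t → Fin r → ℝ) (hθ : ∀ i j, θ i j ∈ Set.Ico (0 : ℝ) 1)
    (roots : Fin t → Finset ℂ)
    (hroots : ∀ i, ∀ α : ℂ, α ∈ roots i ↔ Polynomial.aeval α (P i) = 0)
    (hcard : ∀ i, (roots i).card = r)
    (hparam : ∀ i, ∀ α : ℂ, α ∈ roots i ↔ ∃ j, α = eReal (θ i j))
    (hdisj : ∀ i j, i ≠ j → Disjoint (roots i) (roots j))
    (hprod : ∀ i, ∏ α ∈ roots i, α = 1)
    (hGal : ∀ τ : Equiv.Perm ℂ, (∀ i, ∀ α ∈ roots i, τ α ∈ roots i) →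
      ∃ g : ℂ ≃ₐ[E] ℂ, ∀ i, ∀ α ∈ roots i, g α = τ α) :
    LinearIndependent ℚ (fun x : Option (Fin t × Fin (r - 1)) =>
      x.elim (1 : ℝ) (fun p => θ p.1 (Fin.castLE (Nat.sub_le r 1) p.2))) := by
  obtain ⟨s, rfl⟩ : ∃ s, r = s + 1 := ⟨r - 1, by omega⟩
  rw [← LinearIndependent.iff_fractionRing ℤ ℚ, Fintype.linearIndependent_iff]
  intro c hc
  change Option (Fin t × Fin s) → ℤ at c
  have hc : c none + ∑ p : Fin t × Fin s, (c (some p) : ℝ) * θ p.1 p.2.castSucc = 0 := by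
    have h := hc
    erw [Fintype.sum_option] at h
    simp only [Option.elim, zsmul_eq_mul, mul_one] at h
    exact h
  set n : Fin t → Fin (s + 1) → ℤ := fun i => Fin.snoc (fun j => c (some (i, j))) 0 with hnd
  have hn1 : ∀ i (j : Fin s), n i j.castSucc = c (some (i, j)) := by
    intro i j; simp [hnd]
  have hn2 : ∀ i, n i (Fin.last s) = 0 := by
    intro i; simp [hnd]
  have hsum : ∑ p : Fin t × Fin (s + 1), (n p.1 p.2 : ℝ) * θ p.1 p.2 = - c none := by
    rw [Fintype.sum_prod_type] at hc ⊢
    simp only [Fin.sum_univ_castSucc, hn1, hn2]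
    push_cast
    simp only [zero_mul, add_zero]
    linarith
  have hprodn : ∏ p : Fin t × Fin (s + 1), eReal (θ p.1 p.2) ^ n p.1 p.2 = 1 := by
    have : ∀ p : Fin t × Fin (s + 1), eReal (θ p.1 p.2) ^ n p.1 p.2 =
        Complex.exp (2 * Real.pi * Complex.I * (((n p.1 p.2 : ℝ) * θ p.1 p.2 : ℝ) : ℂ)) := by
      intro p
      rw [eReal, ← Complex.exp_int_mul]
      congr 1
      push_cast
      ring
    simp only [this]
    rw [← Complex.exp_sum, ← Finset.mul_sum, ← Complex.ofReal_sum, hsum, Complex.exp_eq_one_iff]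
    exact ⟨- c none, by push_cast; ring⟩
  have hconst := key_const E t (s + 1) hr (fun i j => eReal (θ i j)) roots hcard hparam
    (fun i j => Complex.exp_ne_zero _) hdisj hprod hGal n hprodn
  have hz : ∀ p : Fin t × Fin s, c (some p) = 0 := by
    rintro ⟨i, j⟩
    rw [← hn1, hconst i _ (Fin.last s), hn2]
  rintro (_ | p)
  · simp only [hz] at hc
    simpa using hc
  · exact hz p
end
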